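/- arXiv:1411.4755 — 6 statements merged into one kernel-verified Lean document; each statement's English description precedes it below -/
import Mathlib

section
/- For every unit vector ψ in (ℂ²)^{⊗N} (a pure state of N qubits), the length of correlations satisfies C(ψ) ≥ 1; equivalently, the random correlation R(ψ) = C(ψ)/3^N satisfies R(ψ) ≥ 1/3^N. -/
open Matrix

/-- The three Pauli matrices. -/
noncomputable def pauli : Fin 3 → Matrix (Fin 2) (Fin 2) ℂ :=
  ![!![0, 1; 1, 0], !![0, -Complex.I; Complex.I, 0], !![1, 0; 0, -1]]

/-- The tensor product `σ_{j₁} ⊗ ⋯ ⊗ σ_{j_N}` acting on `(ℂ²)^{⊗N}`,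
realized as a matrix indexed by `Fin N → Fin 2`. -/
noncomputable def pauliTensor {N : ℕ} (j : Fin N → Fin 3) :
    Matrix (Fin N → Fin 2) (Fin N → Fin 2) ℂ :=
  Matrix.of fun a b => ∏ n, pauli (j n) (a n) (b n)

/-- The length of correlations `C(ψ) = Σ_j ⟨ψ|σ_{j₁}⊗⋯⊗σ_{j_N}|ψ⟩²`. -/
noncomputable def corrLen {N : ℕ} (ψ : (Fin N → Fin 2) → ℂ) : ℝ :=
  ∑ j : Fin N → Fin 3, ((star ψ ⬝ᵥ (pauliTensor j).mulVec ψ).re) ^ 2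

/-- The matrix `⨂ n, A n` indexed by functions. -/
def piTensor {ι κ R : Type*} [Fintype ι] [CommSemiring R] (A : ι → Matrix κ κ R) :
    Matrix (ι → κ) (ι → κ) R :=
  Matrix.of fun a b => ∏ n, A n (a n) (b n)

theorem piTensor_mul {ι κ R : Type*} [Fintype ι] [DecidableEq ι] [Fintype κ] [CommSemiring R]
    (A B : ι → Matrix κ κ R) :
    piTensor A * piTensor B = piTensor fun n => A n * B n := by
  ext a b
  simp only [piTensor, Matrix.mul_apply, Matrix.of_apply, Fintype.prod_sum,
    Finset.prod_mul_distrib]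

theorem piTensor_isHermitian {ι κ R : Type*} [Fintype ι] [CommSemiring R] [StarRing R]
    {A : ι → Matrix κ κ R} (hA : ∀ n, (A n).IsHermitian) : (piTensor A).IsHermitian := by
  ext a b
  simp only [piTensor, Matrix.conjTranspose_apply, Matrix.of_apply, star_prod]
  exact Finset.prod_congr rfl fun n _ => (hA n).apply _ _

theorem pauli_isHermitian (i : Fin 3) : (pauli i).IsHermitian := by
  ext a b
  fin_cases i <;> fin_cases a <;> fin_cases b <;> simp [pauli]

theorem pauliTensor_isHermitian {N : ℕ} (j : Fin N → Fin 3) : (pauliTensor j).IsHermitian :=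
  piTensor_isHermitian fun n => pauli_isHermitian (j n)

/-- The eigenvalue of the swap on the symmetric (`false`) or antisymmetric (`true`) subspace
of `ℂ² ⊗ ℂ²`. -/
def swapSign (b : Bool) : ℝ := if b then -1 else 1

/-- The eigenvalue of `∑ i, σ_i ⊗ σ_i` on the symmetric (`false`) or antisymmetric (`true`)
subspace of `ℂ² ⊗ ℂ²`. -/
def pauliEigenvalue (b : Bool) : ℝ := if b then -3 else 1

/-- The projection of `ℂ² ⊗ ℂ²` onto its symmetric (`false`) or antisymmetric (`true`)
subspace. -/
noncomputable def swapProj (b : Bool) : Matrix (Fin 2 × Fin 2) (Fin 2 × Fin 2) ℂ :=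
  Matrix.of fun p q =>
    ((if p = q then 1 else 0) + swapSign b * (if p.swap = q then 1 else 0)) / 2

theorem swapProj_isHermitian (b : Bool) : (swapProj b).IsHermitian := by
  ext ⟨a, a'⟩ ⟨c, c'⟩
  cases b <;> fin_cases a <;> fin_cases a' <;> fin_cases c <;> fin_cases c' <;>
    simp [swapProj, swapSign]

theorem swapProj_mul_self (b : Bool) : swapProj b * swapProj b = swapProj b := by
  ext ⟨a, a'⟩ ⟨c, c'⟩
  cases b <;> fin_cases a <;> fin_cases a' <;> fin_cases c <;> fin_cases c' <;>
    norm_num [swapProj, swapSign, Matrix.mul_apply, Fintype.sum_prod_type]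

theorem swapProj_swap (b : Bool) (p q : Fin 2 × Fin 2) :
    swapProj b p q.swap = swapSign b * swapProj b p q := by
  obtain ⟨a, a'⟩ := p
  obtain ⟨c, c'⟩ := q
  cases b <;> fin_cases a <;> fin_cases a' <;> fin_cases c <;> fin_cases c' <;>
    norm_num [swapProj, swapSign]

theorem sum_swapProj (p q : Fin 2 × Fin 2) :
    ∑ b, swapProj b p q = if p = q then 1 else 0 := by
  simp only [Fintype.sum_bool, swapProj, swapSign, Matrix.of_apply, if_true,
    Bool.false_eq_true, if_false, Complex.ofReal_neg, Complex.ofReal_one]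
  ring

theorem sum_pauli_mul_pauli (a a' c c' : Fin 2) :
    ∑ i, pauli i a c * pauli i a' c' =
      ∑ b, (pauliEigenvalue b : ℂ) * swapProj b (a, a') (c, c') := by
  have h₀ : pauli 0 = !![0, 1; 1, 0] := rfl
  have h₁ : pauli 1 = !![0, -Complex.I; Complex.I, 0] := rfl
  have h₂ : pauli 2 = !![1, 0; 0, -1] := rfl
  rw [Fin.sum_univ_three, h₀, h₁, h₂]
  fin_cases a <;> fin_cases a' <;> fin_cases c <;> fin_cases c' <;>
    norm_num [swapProj, swapSign, pauliEigenvalue]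

/-- The projection of `(ℂ²)^{⊗N} ⊗ (ℂ²)^{⊗N}` onto the subspace on which the swap of the two
`n`-th factors acts by `swapSign (s n)`. -/
noncomputable def swapProjTensor {N : ℕ} (s : Fin N → Bool) :
    Matrix ((Fin N → Fin 2) × (Fin N → Fin 2)) ((Fin N → Fin 2) × (Fin N → Fin 2)) ℂ :=
  let e := (Equiv.arrowProdEquivProdArrow (Fin N) (fun _ => Fin 2) (fun _ => Fin 2)).symm
  (piTensor fun n => swapProj (s n)).submatrix e e

theorem swapProjTensor_apply {N : ℕ} (s : Fin N → Bool) (p q : (Fin N → Fin 2) × (Fin N → Fin 2)) :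
    swapProjTensor s p q = ∏ n, swapProj (s n) (p.1 n, p.2 n) (q.1 n, q.2 n) :=
  rfl

theorem swapProjTensor_isHermitian {N : ℕ} (s : Fin N → Bool) : (swapProjTensor s).IsHermitian :=
  (piTensor_isHermitian fun n => swapProj_isHermitian (s n)).submatrix _

theorem swapProjTensor_mul_self {N : ℕ} (s : Fin N → Bool) :
    swapProjTensor s * swapProjTensor s = swapProjTensor s := by
  simp only [swapProjTensor, Matrix.submatrix_mul_equiv, piTensor_mul, swapProj_mul_self]

open scoped ComplexOrder in
theorem swapProjTensor_posSemidef {N : ℕ} (s : Fin N → Bool) : (swapProjTensor s).PosSemidef := by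
  have h := Matrix.posSemidef_conjTranspose_mul_self (swapProjTensor s)
  rwa [(swapProjTensor_isHermitian s).eq, swapProjTensor_mul_self] at h

theorem sum_swapProjTensor {N : ℕ} : ∑ s : Fin N → Bool, swapProjTensor s = 1 := by
  ext p q
  simp only [Matrix.sum_apply, swapProjTensor_apply]
  rw [← Fintype.prod_sum fun n b => swapProj b (p.1 n, p.2 n) (q.1 n, q.2 n)]
  simp only [sum_swapProj, Finset.prod_ite_zero, Matrix.one_apply, Prod.ext_iff, funext_iff,
    Finset.mem_univ, true_imp_iff, forall_and, Finset.prod_const_one]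

/-- The vector `ψ ⊗ ψ`. -/
def tensorSquare {κ R : Type*} [Mul R] (ψ : κ → R) (p : κ × κ) : R := ψ p.1 * ψ p.2

theorem swapProjTensor_mulVec_tensorSquare {N : ℕ} (s : Fin N → Bool) (ψ : (Fin N → Fin 2) → ℂ) :
    swapProjTensor s *ᵥ tensorSquare ψ =
      ((∏ n, swapSign (s n) : ℝ) : ℂ) • (swapProjTensor s *ᵥ tensorSquare ψ) := by
  ext p
  simp only [Matrix.mulVec, dotProduct, Pi.smul_apply, smul_eq_mul, Finset.mul_sum]
  rw [← (Equiv.prodComm _ _).sum_comp]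
  refine Finset.sum_congr rfl fun q _ => ?_
  have h : swapProjTensor s p q.swap =
      ((∏ n, swapSign (s n) : ℝ) : ℂ) * swapProjTensor s p q := by
    simp only [swapProjTensor_apply, Complex.ofReal_prod, ← Finset.prod_mul_distrib]
    exact Finset.prod_congr rfl fun n _ => swapProj_swap (s n) _ (q.1 n, q.2 n)
  rw [Equiv.prodComm_apply, h, mul_assoc]
  simp only [tensorSquare, Prod.fst_swap, Prod.snd_swap, mul_comm (ψ q.2)]

/-- The squared norm of the component of `ψ ⊗ ψ` in the range of `swapProjTensor s`. -/
noncomputable def swapWeight {N : ℕ} (ψ : (Fin N → Fin 2) → ℂ) (s : Fin N → Bool) : ℂ :=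
  star (tensorSquare ψ) ⬝ᵥ (swapProjTensor s *ᵥ tensorSquare ψ)

open scoped ComplexOrder in
theorem swapWeight_re_nonneg {N : ℕ} (ψ : (Fin N → Fin 2) → ℂ) (s : Fin N → Bool) :
    0 ≤ (swapWeight ψ s).re :=
  (swapProjTensor_posSemidef s).re_dotProduct_nonneg _

theorem sum_swapWeight {N : ℕ} (ψ : (Fin N → Fin 2) → ℂ) :
    ∑ s, swapWeight ψ s = ((∑ x, Complex.normSq (ψ x) : ℝ) : ℂ) ^ 2 := by
  simp only [swapWeight]
  rw [← dotProduct_sum, ← Matrix.sum_mulVec, sum_swapProjTensor, Matrix.one_mulVec, sq]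
  simp only [dotProduct, tensorSquare, Pi.star_apply, star_mul', Complex.ofReal_sum,
    Fintype.sum_mul_sum, Fintype.sum_prod_type, Complex.normSq_eq_conj_mul_self, starRingEnd_apply]
  refine Finset.sum_congr rfl fun x _ => Finset.sum_congr rfl fun y _ => ?_
  ring

theorem sum_pauliTensor_mul_pauliTensor {N : ℕ} (a a' c c' : Fin N → Fin 2) :
    ∑ j, pauliTensor j a c * pauliTensor j a' c' =
      ∑ s, ((∏ n, pauliEigenvalue (s n) : ℝ) : ℂ) * swapProjTensor s (a, a') (c, c') := by
  simp only [pauliTensor, Matrix.of_apply, swapProjTensor_apply, Complex.ofReal_prod,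
    ← Finset.prod_mul_distrib]
  rw [← Fintype.prod_sum fun n i => pauli i (a n) (c n) * pauli i (a' n) (c' n),
    ← Fintype.prod_sum fun n b => (pauliEigenvalue b : ℂ) * swapProj b (a n, a' n) (c n, c' n)]
  exact Finset.prod_congr rfl fun n _ => sum_pauli_mul_pauli _ _ _ _

theorem corrLen_eq_sum_swapWeight {N : ℕ} (ψ : (Fin N → Fin 2) → ℂ) :
    (corrLen ψ : ℂ) = ∑ s, ((∏ n, pauliEigenvalue (s n) : ℝ) : ℂ) * swapWeight ψ s := by
  have hre (j : Fin N → Fin 3) : (((star ψ ⬝ᵥ (pauliTensor j).mulVec ψ).re : ℝ) : ℂ) =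
      star ψ ⬝ᵥ (pauliTensor j).mulVec ψ :=
    Complex.ext rfl ((pauliTensor_isHermitian j).im_star_dotProduct_mulVec_self ψ).symm
  have hsq (j : Fin N → Fin 3) : (star ψ ⬝ᵥ (pauliTensor j).mulVec ψ) ^ 2 =
      ∑ p : (Fin N → Fin 2) × (Fin N → Fin 2), ∑ q : (Fin N → Fin 2) × (Fin N → Fin 2),
        star (tensorSquare ψ p) * tensorSquare ψ q *
          (pauliTensor j p.1 q.1 * pauliTensor j p.2 q.2) := by
    have h : star ψ ⬝ᵥ (pauliTensor j).mulVec ψ =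
        ∑ a, ∑ c, star ψ a * (pauliTensor j a c * ψ c) := by
      simp only [dotProduct, Matrix.mulVec, Finset.mul_sum]
    simp only [h, sq, Fintype.sum_mul_sum, Fintype.sum_prod_type]
    refine Finset.sum_congr rfl fun a _ => Finset.sum_congr rfl fun a' _ => ?_
    refine Finset.sum_congr rfl fun c _ => Finset.sum_congr rfl fun c' _ => ?_
    simp only [tensorSquare, Pi.star_apply, star_mul']
    ring
  simp only [corrLen, Complex.ofReal_sum, Complex.ofReal_pow, hre, hsq]
  rw [Finset.sum_comm]
  simp only [swapWeight, dotProduct, Matrix.mulVec, Finset.mul_sum, Pi.star_apply]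
  rw [Finset.sum_comm (s := (Finset.univ : Finset (Fin N → Bool)))]
  refine Finset.sum_congr rfl fun p _ => ?_
  rw [Finset.sum_comm, Finset.sum_comm (s := (Finset.univ : Finset (Fin N → Bool)))]
  refine Finset.sum_congr rfl fun q _ => ?_
  rw [← Finset.mul_sum, sum_pauliTensor_mul_pauliTensor, Finset.mul_sum]
  refine Finset.sum_congr rfl fun s _ => ?_
  ring

theorem swapWeight_re_le {N : ℕ} (ψ : (Fin N → Fin 2) → ℂ) (s : Fin N → Bool) :
    (swapWeight ψ s).re ≤ (∏ n, pauliEigenvalue (s n)) * (swapWeight ψ s).re := by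
  have hsign : (swapWeight ψ s).re = (∏ n, swapSign (s n)) * (swapWeight ψ s).re := by
    have h : swapWeight ψ s = ((∏ n, swapSign (s n) : ℝ) : ℂ) * swapWeight ψ s := by
      conv_lhs => rw [swapWeight, swapProjTensor_mulVec_tensorSquare, dotProduct_smul]
      rfl
    have h' := congrArg Complex.re h
    rwa [Complex.re_ofReal_mul] at h'
  have heig : ∏ n, pauliEigenvalue (s n) =
      (∏ n, |pauliEigenvalue (s n)|) * ∏ n, swapSign (s n) := by
    rw [← Finset.prod_mul_distrib]
    refine Finset.prod_congr rfl fun n _ => ?_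
    cases s n <;> norm_num [pauliEigenvalue, swapSign]
  have habs : 1 ≤ ∏ n, |pauliEigenvalue (s n)| := by
    refine Finset.one_le_prod fun n _ => ?_
    cases s n <;> norm_num [pauliEigenvalue]
  rw [heig, mul_assoc, ← hsign]
  exact le_mul_of_one_le_left (swapWeight_re_nonneg ψ s) habs

/-- Theorem 1 of the paper: for every pure state (unit vector) of `N` qubits,
the length of correlations satisfies `C(ψ) ≥ 1`; equivalently the random
correlation `R(ψ) = C(ψ)/3^N` satisfies `R(ψ) ≥ 1/3^N`. -/
theorem corrLen_ge_one {N : ℕ} (ψ : (Fin N → Fin 2) → ℂ)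
    (hψ : ∑ x, Complex.normSq (ψ x) = 1) :
    1 ≤ corrLen ψ ∧ (1 : ℝ) / 3 ^ N ≤ corrLen ψ / 3 ^ N := by
  have h : 1 ≤ corrLen ψ := by
    have hC := congrArg Complex.re (corrLen_eq_sum_swapWeight ψ)
    have hone := congrArg Complex.re (sum_swapWeight ψ)
    simp only [hψ, Complex.ofReal_one, one_pow, Complex.one_re, Complex.re_sum] at hone
    simp only [Complex.ofReal_re, Complex.re_sum, Complex.re_ofReal_mul] at hC
    rw [hC, ← hone]
    exact Finset.sum_le_sum fun s _ => swapWeight_re_le ψ s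
  exact ⟨h, by gcongr⟩
end

section
/- Let H = σ_x ⊗ σ_x + σ_y ⊗ σ_y + σ_z ⊗ σ_z on ℂ² ⊗ ℂ² and let P be the swap operator on ℂ² ⊗ ℂ². Then for every vector Ψ in (ℂ² ⊗ ℂ²)^{⊗N} that is invariant under the simultaneous swap of every pair, i.e. P^{⊗N} Ψ = Ψ, one has ⟨Ψ| H^{⊗N} |Ψ⟩ ≥ ‖Ψ‖². In other words, the operator H^{⊗N} is bounded below by the identity on the symmetric subspace, its eigenvalues restricted to that subspace being (−3)^{2k} = 9^k ≥ 1. -/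
open Matrix Kronecker

/-- The two-qubit Heisenberg operator `H = σ_x ⊗ σ_x + σ_y ⊗ σ_y + σ_z ⊗ σ_z`. -/
noncomputable def heisenberg : Matrix (Fin 2 × Fin 2) (Fin 2 × Fin 2) ℂ :=
  ∑ j : Fin 3, pauli j ⊗ₖ pauli j

/-- The swap operator `P` on `ℂ² ⊗ ℂ²`, `P(a ⊗ b) = b ⊗ a`. -/
noncomputable def swapOp : Matrix (Fin 2 × Fin 2) (Fin 2 × Fin 2) ℂ :=
  Matrix.of fun p q => if p.1 = q.2 ∧ p.2 = q.1 then 1 else 0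

/-- The `N`-fold tensor power `H^{⊗N}` of the Heisenberg operator, acting on
`(ℂ² ⊗ ℂ²)^{⊗N}` (the `n`-th pair of factors is the `n`-th qubit and its copy). -/
noncomputable def heisenbergPow (N : ℕ) :
    Matrix (Fin N → Fin 2 × Fin 2) (Fin N → Fin 2 × Fin 2) ℂ :=
  Matrix.of fun a b => ∏ n, heisenberg (a n) (b n)

/-- The `N`-fold tensor power `P^{⊗N}` of the swap operator. -/
noncomputable def swapPow (N : ℕ) :
    Matrix (Fin N → Fin 2 × Fin 2) (Fin N → Fin 2 × Fin 2) ℂ :=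
  Matrix.of fun a b => ∏ n, swapOp (a n) (b n)

namespace Matrix

variable {ι m R : Type*} [Fintype ι]

/-- The tensor product of a finite family of square matrices. -/
def piKronecker [CommMonoid R] (A : ι → Matrix m m R) : Matrix (ι → m) (ι → m) R :=
  of fun a b => ∏ i, A i (a i) (b i)

theorem piKronecker_mul [DecidableEq ι] [Fintype m] [CommSemiring R] (A B : ι → Matrix m m R) :
    piKronecker (fun i => A i * B i) = piKronecker A * piKronecker B := by
  ext a b
  simp [piKronecker, mul_apply, Finset.prod_univ_sum, Finset.prod_mul_distrib]

theorem piKronecker_one [DecidableEq m] [CommSemiring R] [DecidableEq (ι → m)] :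
    piKronecker (fun _ : ι => (1 : Matrix m m R)) = 1 := by
  ext a b
  simp [piKronecker, one_apply, Fintype.prod_boole, funext_iff]

theorem conjTranspose_piKronecker [CommSemiring R] [StarRing R] (A : ι → Matrix m m R) :
    (piKronecker A)ᴴ = piKronecker fun i => (A i)ᴴ := by
  ext a b
  simp [piKronecker, star_prod]

theorem piKronecker_add [DecidableEq ι] [CommSemiring R] (A B : ι → Matrix m m R) :
    piKronecker (fun i => A i + B i) =
      ∑ s : Finset ι, piKronecker fun i => if i ∈ s then A i else B i := by
  ext a b
  simp only [piKronecker, sum_apply, of_apply, add_apply, Fintype.prod_add]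
  refine Finset.sum_congr rfl fun s _ => ?_
  rw [← Finset.prod_mul_prod_compl s]
  congr 1
  · exact Finset.prod_congr rfl fun i hi => by simp [hi]
  · exact Finset.prod_congr rfl fun i hi => by simp [Finset.mem_compl.1 hi]

open scoped ComplexOrder MatrixOrder in
theorem PosSemidef.piKronecker [DecidableEq ι] [Fintype m] [DecidableEq m]
    {A : ι → Matrix m m ℂ} (hA : ∀ i, (A i).PosSemidef) :
    (piKronecker A).PosSemidef := by
  choose B hB using fun i => CStarAlgebra.nonneg_iff_eq_star_mul_self.1 (hA i).nonneg
  simp only [star_eq_conjTranspose] at hB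
  rw [funext hB, piKronecker_mul, ← conjTranspose_piKronecker]
  exact posSemidef_conjTranspose_mul_self _

open scoped ComplexOrder in
/-- If every `A i` is positive semidefinite, then `⨂ (1 + A i) ≥ 1`. -/
theorem PosSemidef.piKronecker_add_one_sub_one [DecidableEq ι] [Fintype m] [DecidableEq m]
    {A : ι → Matrix m m ℂ} (hA : ∀ i, (A i).PosSemidef) :
    (Matrix.piKronecker (fun i => A i + 1) - 1).PosSemidef := by
  rw [piKronecker_add, ← Finset.add_sum_erase _ _ (Finset.mem_univ ∅)]
  simp only [Finset.notMem_empty, if_false, piKronecker_one, add_sub_cancel_left]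
  refine posSemidef_sum _ fun s _ => PosSemidef.piKronecker fun i => ?_
  split_ifs
  exacts [hA i, PosSemidef.one]

end Matrix

theorem heisenberg_eq : heisenberg = ((1 - swapOp) + 1) * swapOp := by
  ext ⟨a, b⟩ ⟨c, d⟩
  fin_cases a <;> fin_cases b <;> fin_cases c <;> fin_cases d <;>
    simp [heisenberg, pauli, swapOp, Fin.sum_univ_three, Matrix.mul_apply, Matrix.one_apply,
      Fintype.sum_prod_type]

open scoped ComplexOrder in
theorem posSemidef_one_sub_swapOp : (1 - swapOp).PosSemidef := by
  have h : 1 - swapOp = vecMulVec (fun p : Fin 2 × Fin 2 => !![(0 : ℂ), 1; -1, 0] p.1 p.2)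
      (star fun p => !![(0 : ℂ), 1; -1, 0] p.1 p.2) := by
    ext ⟨a, b⟩ ⟨c, d⟩
    fin_cases a <;> fin_cases b <;> fin_cases c <;> fin_cases d <;>
      simp [swapOp, vecMulVec_apply]
  rw [h]
  exact posSemidef_vecMulVec_self_star _

theorem heisenbergPow_eq (N : ℕ) :
    heisenbergPow N = piKronecker (fun _ => (1 - swapOp) + 1) * swapPow N := by
  have h : heisenbergPow N = piKronecker fun _ => heisenberg := rfl
  rw [h, heisenberg_eq, piKronecker_mul]
  rfl

/-- On the symmetric subspace (vectors invariant under the simultaneous swap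
`P^{⊗N}`), the operator `H^{⊗N}` is bounded below by the identity:
`⟨Ψ|H^{⊗N}|Ψ⟩ ≥ ‖Ψ‖²`. -/
theorem heisenbergPow_ge_one_on_symmetric {N : ℕ}
    (Ψ : (Fin N → Fin 2 × Fin 2) → ℂ) (hΨ : (swapPow N).mulVec Ψ = Ψ) :
    (∑ x, Complex.normSq (Ψ x)) ≤ (star Ψ ⬝ᵥ (heisenbergPow N).mulVec Ψ).re := by
  rw [heisenbergPow_eq, ← mulVec_mulVec, hΨ]
  have h := (PosSemidef.piKronecker_add_one_sub_one
    fun _ : Fin N => posSemidef_one_sub_swapOp).re_dotProduct_nonneg Ψ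
  have hn : (star Ψ ⬝ᵥ Ψ).re = ∑ x, Complex.normSq (Ψ x) := by
    simp [dotProduct, Complex.normSq_apply]
  rw [sub_mulVec, one_mulVec, dotProduct_sub, map_sub] at h
  rw [← hn]
  exact sub_nonneg.1 h
end

section
/- Let H_A and H_B be finite-dimensional complex Hilbert spaces and let ψ ∈ H_A ⊗ H_B be a unit vector. If the two-copy vector ψ ⊗ ψ ∈ (H_A ⊗ H_B) ⊗ (H_A ⊗ H_B) is invariant under the operator that exchanges the two H_A factors (i.e. the unitary sending (a ⊗ b) ⊗ (a' ⊗ b') to (a' ⊗ b) ⊗ (a ⊗ b')), then ψ is a product vector: there exist unit vectors φ_A ∈ H_A and φ_B ∈ H_B with ψ = φ_A ⊗ φ_B. -/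
/-- A unit vector that factors as a product factors as a product of unit vectors. -/
lemma exists_unit_factors_of_product {ιA ιB : Type*} [Fintype ιA] [Fintype ιB]
    (ψ : ιA × ιB → ℂ) (hψ : ∑ x, Complex.normSq (ψ x) = 1)
    (f : ιA → ℂ) (g : ιB → ℂ) (hfg : ∀ a b, ψ (a, b) = f a * g b) :
    ∃ (φA : ιA → ℂ) (φB : ιB → ℂ),
      (∑ a, Complex.normSq (φA a) = 1) ∧ (∑ b, Complex.normSq (φB b) = 1) ∧
      ∀ a b, ψ (a, b) = φA a * φB b := by
  set S := ∑ a, Complex.normSq (f a) with hS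
  have hmul : S * ∑ b, Complex.normSq (g b) = 1 := by
    rw [← hψ, Fintype.sum_prod_type, hS, Finset.sum_mul_sum]
    simp only [hfg, map_mul]
  have hS0 : 0 ≤ S := Finset.sum_nonneg fun a _ => Complex.normSq_nonneg _
  have hne : S ≠ 0 := left_ne_zero_of_mul_eq_one hmul
  have hsqrt : (√S : ℂ) ≠ 0 := by
    exact_mod_cast (Real.sqrt_ne_zero hS0).2 hne
  refine ⟨fun a => f a / √S, fun b => √S * g b, ?_, ?_, fun a b => ?_⟩
  · simp only [map_div₀, Complex.normSq_ofReal, Real.mul_self_sqrt hS0]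
    rw [← Finset.sum_div, ← hS, div_self hne]
  · simp only [map_mul, Complex.normSq_ofReal, Real.mul_self_sqrt hS0]
    rw [← Finset.mul_sum, hmul]
  · rw [hfg]
    field_simp

/-- If the two-copy vector `ψ ⊗ ψ` of a bipartite unit vector `ψ ∈ H_A ⊗ H_B`
is invariant under exchanging the two `H_A` factors (the unitary sending
`(a ⊗ b) ⊗ (a' ⊗ b')` to `(a' ⊗ b) ⊗ (a ⊗ b')`), then `ψ` is a product vector.
Here `H_A = ℂ^{ιA}` and `H_B = ℂ^{ιB}` are finite-dimensional Hilbert spaces and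
vectors in `H_A ⊗ H_B` are given by their coefficients `ιA × ιB → ℂ`. -/
theorem product_of_swap_invariant {ιA ιB : Type*} [Fintype ιA] [Fintype ιB]
    (ψ : ιA × ιB → ℂ) (hψ : ∑ x, Complex.normSq (ψ x) = 1)
    (hswap : (fun p : (ιA × ιB) × (ιA × ιB) =>
        ψ (p.2.1, p.1.2) * ψ (p.1.1, p.2.2)) =
      (fun p : (ιA × ιB) × (ιA × ιB) => ψ p.1 * ψ p.2)) :
    ∃ (φA : ιA → ℂ) (φB : ιB → ℂ),
      (∑ a, Complex.normSq (φA a) = 1) ∧ (∑ b, Complex.normSq (φB b) = 1) ∧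
      ∀ a b, ψ (a, b) = φA a * φB b := by
  obtain ⟨⟨a₀, b₀⟩, -, h⟩ :=
    Finset.exists_ne_zero_of_sum_ne_zero (hψ.trans_ne one_ne_zero)
  have h₀ : ψ (a₀, b₀) ≠ 0 := fun h' => h (by rw [h', map_zero])
  refine exists_unit_factors_of_product ψ hψ (fun a => ψ (a, b₀))
    (fun b => ψ (a₀, b) / ψ (a₀, b₀)) fun a b => ?_
  have hab := congrFun hswap ((a₀, b₀), (a, b))
  rw [← mul_div_assoc, eq_div_iff h₀]
  linear_combination -hab
end

section
/- If ψ = φ₁ ⊗ ⋯ ⊗ φ_N with unit vectors φ_n ∈ ℂ², then C(ψ) = 1. In particular, for N = 1 this says that every unit vector φ ∈ ℂ² satisfies ⟨φ|σ_x|φ⟩² + ⟨φ|σ_y|φ⟩² + ⟨φ|σ_z|φ⟩² = 1 (the Bloch vector of a pure qubit state has unit length). -/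
open Matrix

/-- Pauli expectation values are real. -/
lemma pauli_expectation_im (φ : Fin 2 → ℂ) (j : Fin 3) :
    (star φ ⬝ᵥ (pauli j).mulVec φ).im = 0 := by
  fin_cases j <;> simp [pauli, Matrix.mulVec, dotProduct, Fin.sum_univ_two] <;> ring

/-- The squared length of the Bloch vector is the fourth power of the norm of the state. -/
lemma sum_pauli_expectation_sq (φ : Fin 2 → ℂ) :
    ∑ j : Fin 3, ((star φ ⬝ᵥ (pauli j).mulVec φ).re) ^ 2 =
      (∑ x, Complex.normSq (φ x)) ^ 2 := by
  simp [pauli, Matrix.mulVec, dotProduct, Fin.sum_univ_two, Fin.sum_univ_three,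
    Complex.normSq_apply]
  ring

/-- Expectation values of tensor products of Pauli matrices factorize over product states. -/
lemma pauliTensor_expectation_prod {N : ℕ} (φ : Fin N → (Fin 2 → ℂ)) (j : Fin N → Fin 3) :
    (star (fun a : Fin N → Fin 2 => ∏ n, φ n (a n)) ⬝ᵥ
      (pauliTensor j).mulVec (fun a => ∏ n, φ n (a n))) =
      ∏ n, (star (φ n) ⬝ᵥ (pauli (j n)).mulVec (φ n)) := by
  simp only [dotProduct, Matrix.mulVec, pauliTensor, Matrix.of_apply, Pi.star_apply, star_prod,
    ← Finset.prod_mul_distrib, Fintype.prod_sum]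
  simp only [Finset.prod_mul_distrib, Fintype.prod_sum]

/-- The length of correlations is multiplicative over product states. -/
lemma corrLen_prod {N : ℕ} (φ : Fin N → (Fin 2 → ℂ)) :
    corrLen (fun a => ∏ n, φ n (a n)) =
      ∏ n, ∑ j : Fin 3, ((star (φ n) ⬝ᵥ (pauli j).mulVec (φ n)).re) ^ 2 := by
  rw [corrLen, Fintype.prod_sum]
  refine Finset.sum_congr rfl fun j _ => ?_
  have h (n : Fin N) : star (φ n) ⬝ᵥ (pauli (j n)).mulVec (φ n) =
      ((star (φ n) ⬝ᵥ (pauli (j n)).mulVec (φ n)).re : ℂ) :=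
    Complex.ext rfl (pauli_expectation_im (φ n) (j n))
  rw [pauliTensor_expectation_prod, Finset.prod_congr rfl fun n _ => h n, ← Complex.ofReal_prod,
    Complex.ofReal_re, Finset.prod_pow]

/-- Easy direction of Theorem 2 of the paper: every product state of `N` qubits
has length of correlations `C(ψ) = 1`; in particular (`N = 1`) the Bloch vector
of every pure qubit state has unit length. -/
theorem corrLen_of_product :
    (∀ (N : ℕ) (φ : Fin N → (Fin 2 → ℂ)),
      (∀ n, ∑ x, Complex.normSq (φ n x) = 1) →
      corrLen (fun a => ∏ n, φ n (a n)) = 1) ∧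
    (∀ φ : Fin 2 → ℂ, (∑ x, Complex.normSq (φ x) = 1) →
      ∑ j : Fin 3, ((star φ ⬝ᵥ (pauli j).mulVec φ).re) ^ 2 = 1) := by
  refine ⟨fun N φ h => ?_, fun φ h => ?_⟩
  · rw [corrLen_prod]
    exact Finset.prod_eq_one fun n _ => by rw [sum_pauli_expectation_sq, h n, one_pow]
  · rw [sum_pauli_expectation_sq, h, one_pow]
end

section
/- The length of correlations is convex: if ρ = Σ_i p_i ρ_i is a density matrix on (ℂ²)^{⊗N} written as a convex combination (p_i ≥ 0, Σ p_i = 1) of density matrices ρ_i, then C(ρ) ≤ Σ_i p_i C(ρ_i). Consequently, every fully separable state ρ = Σ_i p_i ρ_i^{(1)} ⊗ ⋯ ⊗ ρ_i^{(N)} (with each ρ_i^{(n)} a pure qubit state) satisfies C(ρ) ≤ 1. -/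
open Matrix
open scoped ComplexOrder

/-- The length of correlations of a density matrix:
`C(ρ) = Σ_j Tr(ρ · σ_{j₁} ⊗ ⋯ ⊗ σ_{j_N})²`. -/
noncomputable def corrLenMat {N : ℕ}
    (ρ : Matrix (Fin N → Fin 2) (Fin N → Fin 2) ℂ) : ℝ :=
  ∑ j : Fin N → Fin 3, ((ρ * pauliTensor j).trace.re) ^ 2

/-- The length of correlations is convex on all square matrices. -/
theorem corrLenMat_sum_smul_le {N : ℕ} {ι : Type*} [Fintype ι] (p : ι → ℝ)
    (ρ : ι → Matrix (Fin N → Fin 2) (Fin N → Fin 2) ℂ) (hp : ∀ i, 0 ≤ p i)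
    (hsum : ∑ i, p i = 1) :
    corrLenMat (∑ i, (p i : ℂ) • ρ i) ≤ ∑ i, p i * corrLenMat (ρ i) := by
  simp only [corrLenMat, Finset.mul_sum]
  rw [Finset.sum_comm]
  refine Finset.sum_le_sum fun j _ => ?_
  have hlin : ((∑ i, (p i : ℂ) • ρ i) * pauliTensor j).trace.re =
      ∑ i, p i * (ρ i * pauliTensor j).trace.re := by
    simp [Finset.sum_mul, trace_sum, trace_smul]
  rw [hlin]
  simpa using (even_two.convexOn_pow (𝕜 := ℝ)).map_sum_le
    (fun i _ => hp i) hsum (fun i _ => Set.mem_univ (ρ i * pauliTensor j).trace.re)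

/-- The trace of a product of two tensor products is the product of the traces. -/
theorem trace_tensor_mul_tensor {N : ℕ} (A B : Fin N → Matrix (Fin 2) (Fin 2) ℂ) :
    ((of fun a b : Fin N → Fin 2 => ∏ n, A n (a n) (b n)) *
      of fun a b : Fin N → Fin 2 => ∏ n, B n (a n) (b n)).trace =
      ∏ n, (A n * B n).trace := by
  simp only [trace, diag_apply, mul_apply, of_apply, ← Finset.prod_mul_distrib,
    Fintype.prod_sum]

/-- The components of the Bloch vector of a vector in `ℂ²` are real. -/
theorem trace_vecMulVec_mul_pauli_im (v : Fin 2 → ℂ) (k : Fin 3) :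
    (vecMulVec v (star v) * pauli k).trace.im = 0 := by
  fin_cases k <;>
    simp [pauli, trace, mul_apply, Fin.sum_univ_two, vecMulVec_apply] <;> ring

/-- The squared length of the Bloch vector is the fourth power of the norm of the vector. -/
theorem sum_sq_trace_vecMulVec_mul_pauli (v : Fin 2 → ℂ) :
    ∑ k, (vecMulVec v (star v) * pauli k).trace.re ^ 2 = (∑ x, Complex.normSq (v x)) ^ 2 := by
  simp [pauli, trace, mul_apply, Fin.sum_univ_two, Fin.sum_univ_three, vecMulVec_apply,
    Complex.normSq_apply]
  ring

/-- Pure product states have length of correlations `1`. -/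
theorem corrLenMat_product {N : ℕ} (φ : Fin N → Fin 2 → ℂ)
    (hφ : ∀ n, ∑ x, Complex.normSq (φ n x) = 1) :
    corrLenMat (vecMulVec (fun a => ∏ n, φ n (a n)) (star fun a => ∏ n, φ n (a n))) = 1 := by
  have hprod : vecMulVec (fun a : Fin N → Fin 2 => ∏ n, φ n (a n))
      (star fun a : Fin N → Fin 2 => ∏ n, φ n (a n)) =
      of fun a b : Fin N → Fin 2 => ∏ n, vecMulVec (φ n) (star (φ n)) (a n) (b n) := by
    ext a b
    simp [vecMulVec_apply, Finset.prod_mul_distrib]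
  have htrace (j : Fin N → Fin 3) :
      (vecMulVec (fun a : Fin N → Fin 2 => ∏ n, φ n (a n))
        (star fun a : Fin N → Fin 2 => ∏ n, φ n (a n)) * pauliTensor j).trace.re =
      ∏ n, (vecMulVec (φ n) (star (φ n)) * pauli (j n)).trace.re := by
    rw [hprod, pauliTensor, trace_tensor_mul_tensor _ fun n => pauli (j n),
      ← Complex.ofReal_re (∏ n, (vecMulVec (φ n) (star (φ n)) * pauli (j n)).trace.re),
      Complex.ofReal_prod]
    congr 1
    refine Finset.prod_congr rfl fun n _ => ?_
    apply Complex.ext <;> simp [trace_vecMulVec_mul_pauli_im]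
  simp only [corrLenMat, htrace, ← Finset.prod_pow]
  rw [← Fintype.prod_sum fun n k => (vecMulVec (φ n) (star (φ n)) * pauli k).trace.re ^ 2]
  simp [sum_sq_trace_vecMulVec_mul_pauli, hφ]

/-- Convexity of the length of correlations, and the separability bound of
Appendix B: every fully separable state (a convex combination of pure product
states) satisfies `C(ρ) ≤ 1`. -/
theorem corrLenMat_convex_and_separable_bound {N : ℕ} :
    (∀ (m : ℕ) (p : Fin m → ℝ)
      (ρs : Fin m → Matrix (Fin N → Fin 2) (Fin N → Fin 2) ℂ),
      (∀ i, 0 ≤ p i) → (∑ i, p i = 1) →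
      (∀ i, (ρs i).PosSemidef) → (∀ i, (ρs i).trace = 1) →
      corrLenMat (∑ i, (p i : ℂ) • ρs i) ≤ ∑ i, p i * corrLenMat (ρs i)) ∧
    (∀ (m : ℕ) (p : Fin m → ℝ) (φ : Fin m → Fin N → Fin 2 → ℂ),
      (∀ i, 0 ≤ p i) → (∑ i, p i = 1) →
      (∀ i n, ∑ x, Complex.normSq (φ i n x) = 1) →
      corrLenMat (∑ i, (p i : ℂ) •
        Matrix.vecMulVec (fun a => ∏ n, φ i n (a n))
          (star fun a => ∏ n, φ i n (a n))) ≤ 1) := by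
  refine ⟨fun m p ρ hp hsum _ _ => corrLenMat_sum_smul_le p ρ hp hsum,
    fun m p φ hp hsum hφ => (corrLenMat_sum_smul_le p _ hp hsum).trans_eq ?_⟩
  simp [corrLenMat_product _ (hφ _), hsum]
end

section
/- For every fully separable density matrix ρ = Σ_i p_i ρ_i on (ℂ²)^{⊗N} (p_i ≥ 0, Σ p_i = 1, each ρ_i a pure product state), the fourth moment of the correlation function over uniformly random local directions satisfies ∫_{(S²)^N} E_ρ(u₁,…,u_N)⁴ dμ(u₁)⋯dμ(u_N) ≤ 1/5^N, where E_ρ(u₁,…,u_N) = Σ_{j₁,…,j_N} Tr(ρ σ_{j₁}⊗⋯⊗σ_{j_N}) (u₁)_{j₁}⋯(u_N)_{j_N}. Consequently the standard deviation Δ_ρ of the squared random correlation of any separable state is at most 1/5^{N/2}. -/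
open Matrix MeasureTheory Metric

/-- The uniform (rotation-invariant) probability measure on the unit sphere
`S² ⊂ ℝ³`, obtained by normalizing the surface measure induced by Lebesgue
measure on `ℝ³`. -/
noncomputable def sphereUniform : Measure (sphere (0 : EuclideanSpace ℝ (Fin 3)) 1) :=
  (((volume : Measure (EuclideanSpace ℝ (Fin 3))).toSphere) Set.univ)⁻¹ •
    ((volume : Measure (EuclideanSpace ℝ (Fin 3))).toSphere)

/-- The correlation function `E_ρ(u₁,…,u_N) = Σ_j Tr(ρ σ_{j₁}⊗⋯⊗σ_{j_N}) Π_n (u_n)_{j_n}`. -/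
noncomputable def corrFun {N : ℕ} (ρ : Matrix (Fin N → Fin 2) (Fin N → Fin 2) ℂ)
    (u : Fin N → sphere (0 : EuclideanSpace ℝ (Fin 3)) 1) : ℝ :=
  ∑ j : Fin N → Fin 3,
    ((ρ * pauliTensor j).trace.re) * ∏ n, (u n : EuclideanSpace ℝ (Fin 3)) (j n)

/-- Integration in polar coordinates of a power of a linear form against a Gaussian weight. -/
lemma integral_inner_pow_mul_exp_neg_norm_sq (b : EuclideanSpace ℝ (Fin 3)) (k : ℕ) :
    ∫ x : EuclideanSpace ℝ (Fin 3), inner ℝ b x ^ k * Real.exp (-‖x‖ ^ 2) =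
      (∫ u : sphere (0 : EuclideanSpace ℝ (Fin 3)) 1, inner ℝ b (u : EuclideanSpace ℝ (Fin 3)) ^ k
        ∂(volume : Measure (EuclideanSpace ℝ (Fin 3))).toSphere) *
      ∫ r in Set.Ioi (0 : ℝ), r ^ (k + 2) * Real.exp (-r ^ 2) := by
  set μ : Measure (EuclideanSpace ℝ (Fin 3)) := volume
  calc
    _ = ∫ x : ({0}ᶜ : Set (EuclideanSpace ℝ (Fin 3))),
          inner ℝ b x.1 ^ k * Real.exp (-‖x.1‖ ^ 2) ∂(μ.comap (↑)) := by
      rw [integral_subtype_comap (measurableSet_singleton _).compl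
        fun x ↦ inner ℝ b x ^ k * Real.exp (-‖x‖ ^ 2), restrict_compl_singleton]
    _ = ∫ x, inner ℝ b x.1.1 ^ k * (x.2.1 ^ k * Real.exp (-x.2.1 ^ 2))
          ∂μ.toSphere.prod (.volumeIoiPow
            (Module.finrank ℝ (EuclideanSpace ℝ (Fin 3)) - 1)) := by
      rw [← μ.measurePreserving_homeomorphUnitSphereProd.integral_comp
        (Homeomorph.measurableEmbedding _)]
      refine integral_congr_ae (.of_forall fun x ↦ ?_)
      have hx : ‖x.1‖ ≠ 0 := norm_ne_zero_iff.2 x.2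
      simp only [homeomorphUnitSphereProd_apply_fst_coe, homeomorphUnitSphereProd_apply_snd_coe,
        inner_smul_right]
      rw [← mul_assoc, mul_right_comm, mul_right_comm, ← mul_pow, mul_right_comm,
        inv_mul_cancel₀ hx, one_mul]
    _ = _ := by
      rw [integral_prod_mul (fun u : sphere (0 : EuclideanSpace ℝ (Fin 3)) 1 ↦
        inner ℝ b u.1 ^ k) (fun r : Set.Ioi (0 : ℝ) ↦ r.1 ^ k * Real.exp (-r.1 ^ 2))]
      congr 1
      simp only [Measure.volumeIoiPow, ENNReal.ofReal]
      rw [integral_withDensity_eq_integral_smul,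
        integral_subtype_comap measurableSet_Ioi fun a : ℝ ↦ Real.toNNReal
          (a ^ (Module.finrank ℝ (EuclideanSpace ℝ (Fin 3)) - 1)) •
            (a ^ k * Real.exp (-a ^ 2)),
        setIntegral_congr_fun measurableSet_Ioi fun x hx ↦ ?_]
      · rw [NNReal.smul_def, Real.coe_toNNReal _ (pow_nonneg (le_of_lt hx) _)]
        simp only [finrank_euclideanSpace, Fintype.card_fin, smul_eq_mul]
        ring
      · exact (measurable_subtype_coe.pow_const _).real_toNNReal

lemma integral_Ioi_pow_mul_exp_neg_sq (k : ℕ) :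
    ∫ r in Set.Ioi (0 : ℝ), r ^ k * Real.exp (-r ^ 2) = Real.Gamma ((k + 1) / 2) / 2 := by
  have h := integral_rpow_mul_exp_neg_rpow (p := 2) (q := k) two_pos
    (by linarith [Nat.cast_nonneg (α := ℝ) k])
  simp only [Real.rpow_natCast, Real.rpow_two] at h
  rw [h]
  ring

lemma integral_pow_four_mul_exp_neg_sq :
    ∫ t : ℝ, t ^ 4 * Real.exp (-t ^ 2) = Real.Gamma (5 / 2) := by
  have h := integral_comp_abs (f := fun t : ℝ ↦ t ^ 4 * Real.exp (-t ^ 2))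
  simp only [sq_abs, (show Even 4 by decide).pow_abs] at h
  rw [h, integral_Ioi_pow_mul_exp_neg_sq]
  norm_num
  ring_nf

/-- The fourth moment of a unit linear form against the Gaussian weight on `ℝ³`. -/
lemma integral_inner_pow_four_mul_exp_neg_norm_sq {b : EuclideanSpace ℝ (Fin 3)}
    (hb : ‖b‖ = 1) :
    ∫ x : EuclideanSpace ℝ (Fin 3), inner ℝ b x ^ 4 * Real.exp (-‖x‖ ^ 2) =
      Real.Gamma (5 / 2) * Real.pi := by
  have ho : Orthonormal ℝ (({0} : Set (Fin 3)).domRestrict fun _ ↦ b) :=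
    ⟨fun _ ↦ hb, fun i j hij ↦ (hij (Subsingleton.elim i j)).elim⟩
  obtain ⟨e, he⟩ := ho.exists_orthonormalBasis_extension_of_card_eq (by simp)
  have he0 : e 0 = b := he 0 rfl
  let f : Fin 3 → ℝ → ℝ :=
    ![fun t ↦ t ^ 4 * Real.exp (-t ^ 2), fun t ↦ Real.exp (-t ^ 2), fun t ↦ Real.exp (-t ^ 2)]
  let g : EuclideanSpace ℝ (Fin 3) → ℝ := fun y ↦ y 0 ^ 4 * Real.exp (-‖y‖ ^ 2)
  calc
    _ = ∫ x, g (e.repr x) := by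
      simp only [g, e.repr_apply_apply, he0, LinearIsometryEquiv.norm_map]
    _ = ∫ y, g y :=
      e.measurePreserving_repr.integral_comp e.repr.toHomeomorph.measurableEmbedding _
    _ = ∫ z : Fin 3 → ℝ, ∏ i, f i (z i) := by
      rw [← (PiLp.volume_preserving_toLp (Fin 3)).integral_comp
        (MeasurableEquiv.toLp 2 _).measurableEmbedding]
      refine integral_congr_ae (.of_forall fun z ↦ ?_)
      simp only [EuclideanSpace.real_norm_sq_eq, Fin.sum_univ_three, Fin.prod_univ_three, f, g,
        Matrix.cons_val, neg_add, Real.exp_add]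
      ring
    _ = _ := by
      have hg : ∫ t : ℝ, Real.exp (-t ^ 2) = √Real.pi := by
        simpa using integral_gaussian 1
      rw [integral_fintype_prod_volume_eq_prod]
      simp only [Fin.prod_univ_three, f, Matrix.cons_val, hg, integral_pow_four_mul_exp_neg_sq]
      rw [mul_assoc, Real.mul_self_sqrt Real.pi_pos.le]

lemma toSphere_univ_fin_three :
    (volume : Measure (EuclideanSpace ℝ (Fin 3))).toSphere Set.univ =
      ENNReal.ofReal (4 * Real.pi) := by
  rw [Measure.toSphere_apply_univ, EuclideanSpace.volume_ball_fin_three, finrank_euclideanSpace,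
    Fintype.card_fin, ← ENNReal.ofReal_natCast, ENNReal.ofReal_one, one_pow, one_mul,
    ← ENNReal.ofReal_mul (Nat.cast_nonneg _)]
  congr 1
  push_cast
  ring

instance : IsFiniteMeasure sphereUniform where
  measure_univ_lt_top := by
    rw [sphereUniform, Measure.smul_apply, smul_eq_mul, toSphere_univ_fin_three]
    exact ENNReal.mul_lt_top
      (ENNReal.inv_lt_top.2 (ENNReal.ofReal_pos.2 (by positivity))) ENNReal.ofReal_lt_top

lemma integral_inner_pow_four_sphereUniform {b : EuclideanSpace ℝ (Fin 3)} (hb : ‖b‖ = 1) :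
    ∫ u, inner ℝ b (u : EuclideanSpace ℝ (Fin 3)) ^ 4 ∂sphereUniform = 1 / 5 := by
  have h := integral_inner_pow_mul_exp_neg_norm_sq b 4
  rw [integral_inner_pow_four_mul_exp_neg_norm_sq hb, integral_Ioi_pow_mul_exp_neg_sq,
    show (((4 + 2 : ℕ) : ℝ) + 1) / 2 = 5 / 2 + 1 by norm_num,
    Real.Gamma_add_one (by norm_num)] at h
  have hG : Real.Gamma (5 / 2) ≠ 0 := (Real.Gamma_pos_of_pos (by norm_num)).ne'
  rw [sphereUniform, integral_smul_measure, toSphere_univ_fin_three, ENNReal.toReal_inv,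
    ENNReal.toReal_ofReal (by positivity), smul_eq_mul]
  have hI : Real.pi = _ * (5 / 4) := mul_left_cancel₀ hG (h.trans (by ring))
  rw [inv_mul_eq_div, div_eq_iff (by positivity)]
  linarith

/-- The Bloch vector of a qubit state vector. -/
noncomputable def blochVector (v : Fin 2 → ℂ) : EuclideanSpace ℝ (Fin 3) :=
  WithLp.toLp 2 fun j ↦ (∑ x, ∑ y, v x * star (v y) * pauli j y x).re

lemma ofReal_blochVector (v : Fin 2 → ℂ) (j : Fin 3) :
    (blochVector v j : ℂ) = ∑ x, ∑ y, v x * star (v y) * pauli j y x := by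
  apply Complex.ext
  · simp [blochVector]
  · fin_cases j <;> simp [pauli, Fin.sum_univ_two] <;> ring

lemma norm_blochVector {v : Fin 2 → ℂ} (hv : ∑ x, Complex.normSq (v x) = 1) :
    ‖blochVector v‖ = 1 := by
  rw [← sq_eq_sq₀ (norm_nonneg _) zero_le_one, one_pow, ← one_pow 2, ← hv,
    EuclideanSpace.real_norm_sq_eq, Fin.sum_univ_three]
  simp [blochVector, pauli, Fin.sum_univ_two, Complex.normSq_apply]
  ring

lemma trace_vecMulVec_mul_pauliTensor {N : ℕ} (φ : Fin N → Fin 2 → ℂ) (j : Fin N → Fin 3) :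
    (Matrix.vecMulVec (fun a : Fin N → Fin 2 ↦ ∏ n, φ n (a n))
      (star fun a : Fin N → Fin 2 ↦ ∏ n, φ n (a n)) * pauliTensor j).trace = ∏ n, (blochVector (φ n) (j n) : ℂ) := by
  simp only [ofReal_blochVector, Finset.prod_univ_sum, Fintype.piFinset_univ, Matrix.trace,
    Matrix.diag_apply, Matrix.mul_apply, Matrix.vecMulVec_apply, pauliTensor, Matrix.of_apply,
    Pi.star_apply, star_prod, Finset.prod_mul_distrib]

/-- The correlation function of a separable state is the convex combination of the products of
the local correlations of its constituents. -/
lemma corrFun_separable {N m : ℕ} (p : Fin m → ℝ) (φ : Fin m → Fin N → Fin 2 → ℂ)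
    (u : Fin N → sphere (0 : EuclideanSpace ℝ (Fin 3)) 1) :
    corrFun (∑ i, (p i : ℂ) • Matrix.vecMulVec (fun a ↦ ∏ n, φ i n (a n))
      (star fun a ↦ ∏ n, φ i n (a n))) u =
      ∑ i, p i * ∏ n, inner ℝ (blochVector (φ i n)) (u n : EuclideanSpace ℝ (Fin 3)) := by
  simp only [corrFun, Matrix.trace_sum, Matrix.smul_mul, Matrix.trace_smul,
    trace_vecMulVec_mul_pauliTensor, smul_eq_mul, ← Complex.ofReal_prod, ← Complex.ofReal_mul,
    ← Complex.ofReal_sum, Complex.ofReal_re, Finset.sum_mul]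
  rw [Finset.sum_comm]
  refine Finset.sum_congr rfl fun i _ ↦ ?_
  simp only [PiLp.inner_apply, RCLike.inner_apply, conj_trivial, Finset.prod_univ_sum,
    Fintype.piFinset_univ, Finset.mul_sum, Finset.prod_mul_distrib]
  exact Finset.sum_congr rfl fun j _ ↦ by ring

/-- The fourth moment of the correlation function of a separable state is at most `1/5^N`. -/
lemma integral_corrFun_pow_four_le {N m : ℕ} (p : Fin m → ℝ) (φ : Fin m → Fin N → Fin 2 → ℂ)
    (hp : ∀ i, 0 ≤ p i) (hp1 : ∑ i, p i = 1)
    (hφ : ∀ i n, ∑ x, Complex.normSq (φ i n x) = 1) :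
    ∫ u, corrFun (∑ i, (p i : ℂ) • Matrix.vecMulVec (fun a ↦ ∏ n, φ i n (a n))
      (star fun a ↦ ∏ n, φ i n (a n))) u ^ 4 ∂(Measure.pi fun _ : Fin N ↦ sphereUniform) ≤
      1 / 5 ^ N := by
  have hint {g : (Fin N → sphere (0 : EuclideanSpace ℝ (Fin 3)) 1) → ℝ} (hg : Continuous g) :
      Integrable g (Measure.pi fun _ : Fin N ↦ sphereUniform) :=
    hg.integrable_of_hasCompactSupport (.of_compactSpace g)
  simp only [corrFun_separable]
  calc
    _ ≤ ∫ u : Fin N → sphere (0 : EuclideanSpace ℝ (Fin 3)) 1,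
          ∑ i, p i * ∏ n, inner ℝ (blochVector (φ i n)) (u n : EuclideanSpace ℝ (Fin 3)) ^ 4
          ∂(Measure.pi fun _ : Fin N ↦ sphereUniform) := by
      refine integral_mono (hint (by fun_prop)) (hint (by fun_prop)) fun u ↦ ?_
      simpa only [Finset.prod_pow] using Real.pow_arith_mean_le_arith_mean_pow_of_even
        Finset.univ p (fun i ↦ ∏ n, inner ℝ (blochVector (φ i n)) (u n).1)
        (fun i _ ↦ hp i) hp1 (show Even 4 by decide)
    _ = ∑ i, p i * (1 / 5 ^ N) := by
      rw [integral_finsetSum _ fun i _ ↦ hint (by fun_prop)]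
      refine Finset.sum_congr rfl fun i _ ↦ ?_
      rw [integral_const_mul, integral_fintype_prod_eq_prod fun n
        (x : sphere (0 : EuclideanSpace ℝ (Fin 3)) 1) ↦ inner ℝ (blochVector (φ i n)) x.1 ^ 4]
      simp only [integral_inner_pow_four_sphereUniform (norm_blochVector (hφ i _)),
        Finset.prod_const, Finset.card_univ, Fintype.card_fin, one_div, inv_pow]
    _ = 1 / 5 ^ N := by rw [← Finset.sum_mul, hp1, one_mul]

/-- Appendix B of the paper: for every fully separable state
`ρ = Σ_i p_i ρ_i` (a convex combination of pure product states) the fourth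
moment of the correlation function over uniformly random local directions is
at most `1/5^N`, and consequently the standard deviation of the squared random
correlation is at most `1/5^{N/2}`. -/
theorem separable_fourth_moment_bound {N : ℕ} (m : ℕ) (p : Fin m → ℝ)
    (φ : Fin m → Fin N → Fin 2 → ℂ)
    (hp : ∀ i, 0 ≤ p i) (hp1 : ∑ i, p i = 1)
    (hφ : ∀ i n, ∑ x, Complex.normSq (φ i n x) = 1)
    (ρ : Matrix (Fin N → Fin 2) (Fin N → Fin 2) ℂ)
    (hρ : ρ = ∑ i, (p i : ℂ) • Matrix.vecMulVec (fun a => ∏ n, φ i n (a n))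
      (star fun a => ∏ n, φ i n (a n))) :
    (∫ u, corrFun ρ u ^ 4 ∂(Measure.pi fun _ : Fin N => sphereUniform)) ≤ 1 / 5 ^ N ∧
    Real.sqrt ((∫ u, corrFun ρ u ^ 4 ∂(Measure.pi fun _ : Fin N => sphereUniform)) -
        (∫ u, corrFun ρ u ^ 2 ∂(Measure.pi fun _ : Fin N => sphereUniform)) ^ 2)
      ≤ Real.sqrt (1 / 5 ^ N) := by
  subst hρ
  have h := integral_corrFun_pow_four_le p φ hp hp1 hφ
  exact ⟨h, Real.sqrt_le_sqrt ((sub_le_self _ (sq_nonneg _)).trans h)⟩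
end
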